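/- Let m, n ≥ 1, let L : ℝ^m×ℝ^m×ℝ^m×ℝ^n×ℝ^n → ℝ, (x,ẋ,ẍ,a,ȧ) ↦ L, be smooth, let R : ℝ^n → GL(n,ℝ) be smooth, and assume there are constants c^i_{jk} ∈ ℝ such that for all g: c^i_{jk} = [ (∂R^i_s/∂g^u)(g) − (∂R^i_u/∂g^s)(g) ] · (R(g)^{-1})^s_j · (R(g)^{-1})^u_k. Define L̃ : ℝ^m×ℝ^m×ℝ^m×ℝ^n×ℝ^n×ℝ^n → ℝ by L̃(x,ẋ,ẍ,g,ġ,g̈) = L(x,ẋ,ẍ,a,ȧ) with a^j = R(g)^j_i ġ^i and ȧ^k = R(g)^k_i g̈^i + (∂R^k_i/∂g^s)(g) ġ^s ġ^i. Let (x(t),g(t)) be a smooth curve in ℝ^m×ℝ^n satisfying the second-order Euler–Lagrange equations for L̃: d²/dt²(∂L̃/∂ẍ^a) − d/dt(∂L̃/∂ẋ^a) + ∂L̃/∂x^a = 0 and d²/dt²(∂L̃/∂g̈^i) − d/dt(∂L̃/∂ġ^i) + ∂L̃/∂g^i = 0, all partials evaluated along (x(t),x'(t),x''(t),g(t),g'(t),g''(t)).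 Set a^i(t) = R(g(t))^i_j g'^j(t). Then the second-order Hamel equations hold: d²/dt²(∂L/∂ẍ^a) − d/dt(∂L/∂ẋ^a) + ∂L/∂x^a = 0 and (δ^k_i d/dt + c^k_{ij} a^j(t))[ d/dt(∂L/∂ȧ^k) − ∂L/∂a^k ] = 0, where the partials of L are evaluated along (x(t),x'(t),x''(t),a(t),a'(t)) (Einstein summation). -/

import Mathlib

open scoped BigOperators

/-- Partial derivative `∂f/∂g^u` at `g` of a function `f : ℝ^n → ℝ`. -/
noncomputable def pderivCoord {n : ℕ} (f : (Fin n → ℝ) → ℝ) (u : Fin n) (g : Fin n → ℝ) : ℝ :=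
  fderiv ℝ f g (Pi.single u 1)

/-- The unreduced Lagrangian `L̃(x,ẋ,ẍ,g,ġ,g̈) = L(x,ẋ,ẍ,a,ȧ)` with
`a^j = R(g)^j_i ġ^i` and `ȧ^k = R(g)^k_i g̈^i + (∂R^k_i/∂g^s)(g) ġ^s ġ^i`. -/
noncomputable def Ltilde {m n : ℕ}
    (L : (Fin m → ℝ) → (Fin m → ℝ) → (Fin m → ℝ) → (Fin n → ℝ) → (Fin n → ℝ) → ℝ)
    (R : (Fin n → ℝ) → Matrix (Fin n) (Fin n) ℝ)
    (x xd xdd : Fin m → ℝ) (g gd gdd : Fin n → ℝ) : ℝ :=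
  L x xd xdd
    (fun j => ∑ i, R g j i * gd i)
    (fun k => (∑ i, R g k i * gdd i) + ∑ s, ∑ i, pderivCoord (fun g' => R g' k i) s g * gd s * gd i)


lemma pd_symm {n : ℕ} (f : (Fin n → ℝ) → ℝ) (hf : ContDiff ℝ (⊤ : ℕ∞) f) (i j : Fin n)
    (g : Fin n → ℝ) :
    pderivCoord (pderivCoord f i) j g = pderivCoord (pderivCoord f j) i g := by
  have h2 : ContDiffAt ℝ 2 f g := (contDiff_infty.1 hf 2).contDiffAt
  have hs : IsSymmSndFDerivAt ℝ f g := h2.isSymmSndFDerivAt (by simp)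
  have hd : DifferentiableAt ℝ (fderiv ℝ f) g :=
    ((hf.fderiv_right (m := (⊤ : ℕ∞)) (by exact_mod_cast le_top)).differentiable (by simp)) g
  have key : ∀ a b : Fin n, pderivCoord (pderivCoord f a) b g
      = fderiv ℝ (fderiv ℝ f) g (Pi.single b 1) (Pi.single a 1) := by
    intro a b
    unfold pderivCoord
    rw [fderiv_clm_apply hd (differentiableAt_const _)]
    simp
  rw [key, key]
  exact hs _ _

lemma pd_smooth {n : ℕ} (f : (Fin n → ℝ) → ℝ) (hf : ContDiff ℝ (⊤ : ℕ∞) f) (i : Fin n) :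
    ContDiff ℝ (⊤ : ℕ∞) (pderivCoord f i) := by
  unfold pderivCoord
  exact (hf.fderiv_right (m := (⊤ : ℕ∞)) (by exact_mod_cast le_top)).clm_apply contDiff_const

lemma sum_single_pd {n : ℕ} (T : (Fin n → ℝ) →L[ℝ] ℝ) (v : Fin n → ℝ) :
    T v = ∑ k, T (Pi.single k 1) * v k := by
  conv_lhs => rw [pi_eq_sum_univ' v]
  rw [map_sum]
  refine Finset.sum_congr rfl fun k _ => ?_
  rw [map_smul, smul_eq_mul, mul_comm]

lemma pd_curve {n : ℕ} (f : (Fin n → ℝ) → ℝ) (hf : ContDiff ℝ (⊤ : ℕ∞) f)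
    (g : ℝ → Fin n → ℝ) (hg : ContDiff ℝ (⊤ : ℕ∞) g) (t : ℝ) :
    HasDerivAt (fun τ => f (g τ)) (∑ s, pderivCoord f s (g t) * deriv g t s) t := by
  have h1 : HasDerivAt g (deriv g t) t := (hg.differentiable (by simp) t).hasDerivAt
  have h2 := ((hf.differentiable (by simp)) (g t)).hasFDerivAt.comp_hasDerivAt t h1
  rw [sum_single_pd (fderiv ℝ f (g t)) (deriv g t)] at h2
  exact h2

lemma chain2 {n : ℕ} {E : Type*} [NormedAddCommGroup E] [NormedSpace ℝ E]
    (Φ : (Fin n → ℝ) → (Fin n → ℝ) → ℝ)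
    (hΦ : Differentiable ℝ (fun p : (Fin n → ℝ) × (Fin n → ℝ) => Φ p.1 p.2))
    (A B : E → Fin n → ℝ) (v e : E) (A' B' : Fin n → ℝ)
    (hA : ∀ k, DifferentiableAt ℝ (fun w => A w k) v)
    (hB : ∀ k, DifferentiableAt ℝ (fun w => B w k) v)
    (hA' : ∀ k, HasDerivAt (fun s : ℝ => A (v + s • e) k) (A' k) 0)
    (hB' : ∀ k, HasDerivAt (fun s : ℝ => B (v + s • e) k) (B' k) 0) :
    fderiv ℝ (fun w => Φ (A w) (B w)) v e =
      ∑ k, (fderiv ℝ (fun a => Φ a (B v)) (A v) (Pi.single k 1) * A' k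
        + fderiv ℝ (fun b => Φ (A v) b) (B v) (Pi.single k 1) * B' k) := by
  have dA : DifferentiableAt ℝ A v := differentiableAt_pi.2 hA
  have dB : DifferentiableAt ℝ B v := differentiableAt_pi.2 hB
  have hF := (hΦ (A v, B v)).hasFDerivAt
  set T := fderiv ℝ (fun p : (Fin n → ℝ) × (Fin n → ℝ) => Φ p.1 p.2) (A v, B v) with hT
  have dH : DifferentiableAt ℝ (fun w => Φ (A w) (B w)) v :=
    (HasFDerivAt.comp (g := fun p : (Fin n → ℝ) × (Fin n → ℝ) => Φ p.1 p.2)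
      (f := fun w => (A w, B w)) v hF (dA.hasFDerivAt.prodMk dB.hasFDerivAt)).differentiableAt
  have h1 : fderiv ℝ (fun a => Φ a (B v)) (A v) = T.comp (ContinuousLinearMap.inl ℝ _ _) :=
    (HasFDerivAt.comp (g := fun p : (Fin n → ℝ) × (Fin n → ℝ) => Φ p.1 p.2)
      (f := fun w => (w, B v)) (A v) hF (hasFDerivAt_prodMk_left (A v) (B v))).fderiv
  have h2 : fderiv ℝ (fun b => Φ (A v) b) (B v) = T.comp (ContinuousLinearMap.inr ℝ _ _) :=
    (HasFDerivAt.comp (g := fun p : (Fin n → ℝ) × (Fin n → ℝ) => Φ p.1 p.2)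
      (f := fun w => (A v, w)) (B v) hF (hasFDerivAt_prodMk_right (A v) (B v))).fderiv
  have hAl : HasDerivAt (fun s : ℝ => A (v + s • e)) A' 0 := hasDerivAt_pi.2 hA'
  have hBl : HasDerivAt (fun s : ℝ => B (v + s • e)) B' 0 := hasDerivAt_pi.2 hB'
  have hl : HasDerivAt (fun s : ℝ => Φ (A (v + s • e)) (B (v + s • e))) (T (A', B')) 0 := by
    have hF' : HasFDerivAt (fun p : (Fin n → ℝ) × (Fin n → ℝ) => Φ p.1 p.2) T
        ((fun s : ℝ => (A (v + s • e), B (v + s • e))) 0) := by simpa using hF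
    exact hF'.comp_hasDerivAt 0 (hAl.prodMk hBl)
  have h3 : lineDeriv ℝ (fun w => Φ (A w) (B w)) v e = T (A', B') := hl.deriv
  rw [← dH.lineDeriv_eq_fderiv, h3, Finset.sum_add_distrib,
    ← sum_single_pd (fderiv ℝ (fun a => Φ a (B v)) (A v)) A',
    ← sum_single_pd (fderiv ℝ (fun b => Φ (A v) b) (B v)) B', h1, h2]
  simp only [ContinuousLinearMap.comp_apply, ContinuousLinearMap.inl_apply,
    ContinuousLinearMap.inr_apply]
  rw [← map_add]
  simp

lemma line_pd {n : ℕ} (f : (Fin n → ℝ) → ℝ) (hf : ContDiff ℝ (⊤ : ℕ∞) f) (i : Fin n)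
    (g : Fin n → ℝ) :
    HasDerivAt (fun s : ℝ => f (g + s • Pi.single i 1)) (pderivCoord f i g) 0 := by
  have := ((hf.differentiable (by simp)) g).hasFDerivAt.hasLineDerivAt (Pi.single i 1)
  exact this

lemma line_coord {n : ℕ} (v : Fin n → ℝ) (i j : Fin n) :
    HasDerivAt (fun s : ℝ => (v + s • (Pi.single i 1 : Fin n → ℝ)) j) (if j = i then 1 else 0) 0 := by
  have : HasDerivAt (fun s : ℝ => v j + s * (if j = i then (1:ℝ) else 0))
      (1 * (if j = i then 1 else 0)) 0 :=
    ((hasDerivAt_id (0:ℝ)).mul_const _).const_add _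
  simpa [Pi.single_apply] using this

lemma EL_1d {n : ℕ} (P Q r S : Fin n → ℝ → ℝ)
    (hP : ∀ k, ContDiff ℝ (⊤ : ℕ∞) (P k)) (hQ : ∀ k, ContDiff ℝ (⊤ : ℕ∞) (Q k))
    (hr : ∀ k, ContDiff ℝ (⊤ : ℕ∞) (r k)) (hS : ∀ k, ContDiff ℝ (⊤ : ℕ∞) (S k)) (t : ℝ)
    (h : deriv (deriv (fun τ => ∑ k, P k τ * r k τ)) t
      - deriv (fun τ => ∑ k, (Q k τ * r k τ + P k τ * (deriv (r k) τ + S k τ))) t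
      + ∑ k, (Q k t * S k t + P k t * deriv (S k) t) = 0) :
    ∑ k, (deriv (fun τ => deriv (P k) τ - Q k τ) t * r k t
      + (deriv (P k) t - Q k t) * (deriv (r k) t - S k t)) = 0 := by
  have d : ∀ {f : ℝ → ℝ}, ContDiff ℝ (⊤ : ℕ∞) f → ∀ τ, HasDerivAt f (deriv f τ) τ :=
    fun hf τ => (hf.differentiable (by simp) τ).hasDerivAt
  have dd : ∀ {f : ℝ → ℝ}, ContDiff ℝ (⊤ : ℕ∞) f → ContDiff ℝ (⊤ : ℕ∞) (deriv f) :=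
    fun hf => (contDiff_infty_iff_deriv.1 hf).2
  have e1 : deriv (fun τ => ∑ k, P k τ * r k τ)
      = fun τ => ∑ k, (deriv (P k) τ * r k τ + P k τ * deriv (r k) τ) := by
    funext τ
    exact (HasDerivAt.fun_sum fun k _ => (d (hP k) τ).mul (d (hr k) τ)).deriv
  have e2 : deriv (fun τ => ∑ k, (deriv (P k) τ * r k τ + P k τ * deriv (r k) τ)) t = _ :=
    (HasDerivAt.fun_sum fun k _ => ((d (dd (hP k)) t).mul (d (hr k) t)).add
      ((d (hP k) t).mul (d (dd (hr k)) t))).deriv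
  have e3 : deriv (fun τ => ∑ k, (Q k τ * r k τ + P k τ * (deriv (r k) τ + S k τ))) t = _ :=
    (HasDerivAt.fun_sum fun k _ => ((d (hQ k) t).mul (d (hr k) t)).add
      ((d (hP k) t).mul ((d (dd (hr k)) t).add (d (hS k) t)))).deriv
  have e4 : ∀ k, deriv (fun τ => deriv (P k) τ - Q k τ) t = _ :=
    fun k => ((d (dd (hP k)) t).sub (d (hQ k) t)).deriv
  rw [e1, e2, e3, ← Finset.sum_sub_distrib, ← Finset.sum_add_distrib] at h
  rw [← h]
  refine Finset.sum_congr rfl fun k _ => ?_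
  rw [e4]
  simp only [Pi.add_apply]
  ring

/-- Reduction of a second-order `G`-invariant variational problem on a trivialized
principal bundle: if `(x(t),g(t))` satisfies the second-order Euler–Lagrange equations
for `L̃`, then `(x(t),a(t))`, with `a^i(t) = R(g(t))^i_j (g')^j(t)`, satisfies the
second-order Hamel equations for the reduced Lagrangian `L`. -/
theorem second_order_Hamel_equations {m n : ℕ} (hm : 1 ≤ m) (hn : 1 ≤ n)
    (L : (Fin m → ℝ) → (Fin m → ℝ) → (Fin m → ℝ) → (Fin n → ℝ) → (Fin n → ℝ) → ℝ)
    (hL : ContDiff ℝ (⊤ : ℕ∞)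
      (fun q : (Fin m → ℝ) × (Fin m → ℝ) × (Fin m → ℝ) × (Fin n → ℝ) × (Fin n → ℝ) =>
        L q.1 q.2.1 q.2.2.1 q.2.2.2.1 q.2.2.2.2))
    (R : (Fin n → ℝ) → Matrix (Fin n) (Fin n) ℝ)
    (hR : ∀ i j, ContDiff ℝ (⊤ : ℕ∞) (fun g => R g i j))
    (hRinv : ∀ g, IsUnit (R g).det)
    -- the structure constants c^i_{jk} determined by the trivialization R
    (c : Fin n → Fin n → Fin n → ℝ)
    (hc : ∀ (g : Fin n → ℝ) (i j k : Fin n),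
      c i j k = ∑ s, ∑ u,
        (pderivCoord (fun g' => R g' i s) u g - pderivCoord (fun g' => R g' i u) s g)
          * (R g)⁻¹ s j * (R g)⁻¹ u k)
    -- a smooth curve (x(t), g(t))
    (x : ℝ → Fin m → ℝ) (g : ℝ → Fin n → ℝ)
    (hx : ContDiff ℝ (⊤ : ℕ∞) x) (hg : ContDiff ℝ (⊤ : ℕ∞) g)
    -- the second-order Euler–Lagrange equations for L̃, x-part:
    (hELx : ∀ (t : ℝ) (a : Fin m),
      deriv (deriv (fun τ =>
          fderiv ℝ (fun v => Ltilde L R (x τ) (deriv x τ) v (g τ) (deriv g τ) (deriv (deriv g) τ))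
            (deriv (deriv x) τ) (Pi.single a 1))) t
      - deriv (fun τ =>
          fderiv ℝ (fun v => Ltilde L R (x τ) v (deriv (deriv x) τ) (g τ) (deriv g τ) (deriv (deriv g) τ))
            (deriv x τ) (Pi.single a 1)) t
      + fderiv ℝ (fun v => Ltilde L R v (deriv x t) (deriv (deriv x) t) (g t) (deriv g t) (deriv (deriv g) t))
          (x t) (Pi.single a 1) = 0)
    -- the second-order Euler–Lagrange equations for L̃, g-part:
    (hELg : ∀ (t : ℝ) (i : Fin n),
      deriv (deriv (fun τ =>
          fderiv ℝ (fun v => Ltilde L R (x τ) (deriv x τ) (deriv (deriv x) τ) (g τ) (deriv g τ) v)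
            (deriv (deriv g) τ) (Pi.single i 1))) t
      - deriv (fun τ =>
          fderiv ℝ (fun v => Ltilde L R (x τ) (deriv x τ) (deriv (deriv x) τ) (g τ) v (deriv (deriv g) τ))
            (deriv g τ) (Pi.single i 1)) t
      + fderiv ℝ (fun v => Ltilde L R (x t) (deriv x t) (deriv (deriv x) t) v (deriv g t) (deriv (deriv g) t))
          (g t) (Pi.single i 1) = 0)
    -- a^i(t) = R(g(t))^i_j (g')^j(t)
    (aC : ℝ → Fin n → ℝ)
    (haC : ∀ t i, aC t i = ∑ j, R (g t) i j * deriv g t j) :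
    -- the second-order Hamel equations: the x-part ...
    (∀ (t : ℝ) (a : Fin m),
      deriv (deriv (fun τ =>
          fderiv ℝ (fun v => L (x τ) (deriv x τ) v (aC τ) (deriv aC τ))
            (deriv (deriv x) τ) (Pi.single a 1))) t
      - deriv (fun τ =>
          fderiv ℝ (fun v => L (x τ) v (deriv (deriv x) τ) (aC τ) (deriv aC τ))
            (deriv x τ) (Pi.single a 1)) t
      + fderiv ℝ (fun v => L v (deriv x t) (deriv (deriv x) t) (aC t) (deriv aC t))
          (x t) (Pi.single a 1) = 0)
    ∧
    -- ... and the a-part: (δ^k_i d/dt + c^k_{ij} a^j)[d/dt(∂L/∂ȧ^k) − ∂L/∂a^k] = 0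
    (∀ (t : ℝ) (i : Fin n),
      deriv (fun τ =>
          deriv (fun σ =>
            fderiv ℝ (fun v => L (x σ) (deriv x σ) (deriv (deriv x) σ) (aC σ) v)
              (deriv aC σ) (Pi.single i 1)) τ
          - fderiv ℝ (fun v => L (x τ) (deriv x τ) (deriv (deriv x) τ) v (deriv aC τ))
              (aC τ) (Pi.single i 1)) t
      + ∑ k, ∑ j, c k i j * aC t j *
          (deriv (fun σ =>
            fderiv ℝ (fun v => L (x σ) (deriv x σ) (deriv (deriv x) σ) (aC σ) v)
              (deriv aC σ) (Pi.single k 1)) t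
          - fderiv ℝ (fun v => L (x t) (deriv x t) (deriv (deriv x) t) v (deriv aC t))
              (aC t) (Pi.single k 1)) = 0) := by
  have hg1 : ContDiff ℝ (⊤ : ℕ∞) (deriv g) := (contDiff_infty_iff_deriv.1 hg).2
  have hg2 : ContDiff ℝ (⊤ : ℕ∞) (deriv (deriv g)) := (contDiff_infty_iff_deriv.1 hg1).2
  have hx1 : ContDiff ℝ (⊤ : ℕ∞) (deriv x) := (contDiff_infty_iff_deriv.1 hx).2
  have hx2 : ContDiff ℝ (⊤ : ℕ∞) (deriv (deriv x)) := (contDiff_infty_iff_deriv.1 hx1).2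
  have hRs : ∀ k i s, ContDiff ℝ (⊤ : ℕ∞) (pderivCoord (fun g' => R g' k i) s) :=
    fun k i s => pd_smooth _ (hR k i) s
  have hgc : ∀ i, ContDiff ℝ (⊤ : ℕ∞) (fun τ => g τ i) := fun i => contDiff_pi.1 hg i
  have hg1c : ∀ i, ContDiff ℝ (⊤ : ℕ∞) (fun τ => deriv g τ i) := fun i => contDiff_pi.1 hg1 i
  have hRt : ∀ k i, ContDiff ℝ (⊤ : ℕ∞) (fun τ => R (g τ) k i) := fun k i => (hR k i).comp hg
  have haE : aC = fun t i => ∑ j, R (g t) i j * deriv g t j := by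
    funext t i; exact haC t i
  have ha : ContDiff ℝ (⊤ : ℕ∞) aC := by
    rw [haE]
    exact contDiff_pi.2 fun i => ContDiff.sum fun j _ => (hRt i j).mul (hg1c j)
  have ha1 : ContDiff ℝ (⊤ : ℕ∞) (deriv aC) := (contDiff_infty_iff_deriv.1 ha).2
  have hg1d : ∀ t j, HasDerivAt (fun τ => deriv g τ j) (deriv (deriv g) t j) t := fun t j =>
    hasDerivAt_pi.1 ((hg1.differentiable (by simp) t).hasDerivAt) j
  have hda : ∀ t k, deriv aC t k = (∑ i, R (g t) k i * deriv (deriv g) t i)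
      + ∑ s, ∑ i, pderivCoord (fun g' => R g' k i) s (g t) * deriv g t s * deriv g t i := by
    intro t k
    have h1 : HasDerivAt (fun τ => aC τ k) (deriv aC t k) t :=
      hasDerivAt_pi.1 ((ha.differentiable (by simp) t).hasDerivAt) k
    have h2 := HasDerivAt.fun_sum (u := Finset.univ) fun j _ =>
      (pd_curve _ (hR k j) g hg t).mul (hg1d t j)
    have h3 : (fun τ => aC τ k) = fun τ => ∑ j, R (g τ) k j * deriv g τ j := by
      funext τ; exact haC τ k
    rw [h3] at h1
    rw [h1.unique h2, Finset.sum_add_distrib, add_comm, Finset.sum_comm (γ := Fin n)]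
    congr 1
    exact Finset.sum_congr rfl fun j _ => Finset.sum_mul _ _ _
  have hAe : ∀ t, (fun j => ∑ i, R (g t) j i * deriv g t i) = aC t := fun t => by
    funext j; exact (haC t j).symm
  have hBe : ∀ t, (fun k => (∑ i, R (g t) k i * deriv (deriv g) t i)
      + ∑ s, ∑ i, pderivCoord (fun g' => R g' k i) s (g t) * deriv g t s * deriv g t i)
      = deriv aC t := fun t => by
    funext j; exact (hda t j).symm
  refine ⟨fun t a => ?_, ?_⟩
  · have h := hELx t a
    simp only [Ltilde, hAe, hBe] at h
    exact h
  set P : Fin n → ℝ → ℝ := fun k σ =>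
    fderiv ℝ (fun v => L (x σ) (deriv x σ) (deriv (deriv x) σ) (aC σ) v)
              (deriv aC σ) (Pi.single k 1) with hPdef
  set Q : Fin n → ℝ → ℝ := fun k τ =>
    fderiv ℝ (fun v => L (x τ) (deriv x τ) (deriv (deriv x) τ) v (deriv aC τ))
              (aC τ) (Pi.single k 1) with hQdef
  have hP : ∀ k, ContDiff ℝ (⊤ : ℕ∞) (P k) := by
    intro k
    refine ContDiff.clm_apply (ContDiff.fderiv (m := (⊤ : ℕ∞)) (n := (⊤ : ℕ∞)) ?_ ha1
      (by exact_mod_cast le_top)) contDiff_const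
    exact hL.comp (g := fun q : (Fin m → ℝ) × (Fin m → ℝ) × (Fin m → ℝ) × (Fin n → ℝ) × (Fin n → ℝ) =>
        L q.1 q.2.1 q.2.2.1 q.2.2.2.1 q.2.2.2.2)
      (f := fun p : ℝ × (Fin n → ℝ) => (x p.1, deriv x p.1, deriv (deriv x) p.1, aC p.1, p.2))
      ((hx.comp contDiff_fst).prodMk ((hx1.comp contDiff_fst).prodMk ((hx2.comp contDiff_fst).prodMk
        ((ha.comp contDiff_fst).prodMk contDiff_snd))))
  have hQ : ∀ k, ContDiff ℝ (⊤ : ℕ∞) (Q k) := by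
    intro k
    refine ContDiff.clm_apply (ContDiff.fderiv (m := (⊤ : ℕ∞)) (n := (⊤ : ℕ∞)) ?_ ha
      (by exact_mod_cast le_top)) contDiff_const
    exact hL.comp (g := fun q : (Fin m → ℝ) × (Fin m → ℝ) × (Fin m → ℝ) × (Fin n → ℝ) × (Fin n → ℝ) =>
        L q.1 q.2.1 q.2.2.1 q.2.2.2.1 q.2.2.2.2)
      (f := fun p : ℝ × (Fin n → ℝ) => (x p.1, deriv x p.1, deriv (deriv x) p.1, p.2, deriv aC p.1))
      ((hx.comp contDiff_fst).prodMk ((hx1.comp contDiff_fst).prodMk ((hx2.comp contDiff_fst).prodMk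
        (contDiff_snd.prodMk (ha1.comp contDiff_fst)))))
  have hΦ : ∀ X X1 X2, Differentiable ℝ (fun p : (Fin n → ℝ) × (Fin n → ℝ) => L X X1 X2 p.1 p.2) := by
    intro X X1 X2
    have := hL.comp (g := fun q : (Fin m → ℝ) × (Fin m → ℝ) × (Fin m → ℝ) × (Fin n → ℝ) × (Fin n → ℝ) =>
        L q.1 q.2.1 q.2.2.1 q.2.2.2.1 q.2.2.2.2)
      (f := fun p : (Fin n → ℝ) × (Fin n → ℝ) => (X, X1, X2, p.1, p.2))
      (contDiff_const.prodMk (contDiff_const.prodMk (contDiff_const.prodMk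
        (contDiff_fst.prodMk contDiff_snd))))
    exact this.differentiable (by simp)
  have hRd : ∀ k i, Differentiable ℝ (fun g' => R g' k i) := fun k i =>
    (hR k i).differentiable (by simp)
  have hRsd : ∀ k i s, Differentiable ℝ (fun g' => pderivCoord (fun g' => R g' k i) s g') :=
    fun k i s => (hRs k i s).differentiable (by simp)
  -- the auxiliary functions
  set S : Fin n → Fin n → ℝ → ℝ := fun i k τ =>
    ∑ s, pderivCoord (fun g' => R g' k s) i (g τ) * deriv g τ s with hSdef
  have hS : ∀ i k, ContDiff ℝ (⊤ : ℕ∞) (S i k) := fun i k =>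
    ContDiff.sum fun s _ => ((hRs k s i).comp hg).mul (hg1c s)
  have hr' : ∀ k i t, deriv (fun τ => R (g τ) k i) t
      = ∑ s, pderivCoord (fun g' => R g' k i) s (g t) * deriv g t s := fun k i t =>
    (pd_curve _ (hR k i) g hg t).deriv
  have hS' : ∀ i k t, deriv (S i k) t = (∑ s, pderivCoord (fun g' => R g' k s) i (g t)
        * deriv (deriv g) t s) + ∑ s, ∑ l, pderivCoord (fun g' => pderivCoord (fun g' => R g' k l) s g') i (g t)
          * deriv g t s * deriv g t l := by
    intro i k t
    have h2 := HasDerivAt.fun_sum (u := Finset.univ) fun j _ =>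
      (pd_curve _ (hRs k j i) g hg t).mul (hg1d t j)
    have h3 : deriv (S i k) t = _ := HasDerivAt.deriv h2
    rw [h3, Finset.sum_add_distrib, add_comm, Finset.sum_comm (γ := Fin n)]
    congr 1
    refine Finset.sum_congr rfl fun j _ => ?_
    rw [Finset.sum_mul]
    refine Finset.sum_congr rfl fun l _ => ?_
    rw [pd_symm _ (hR k j)]
  have E1 : ∀ i τ, fderiv ℝ (fun v => Ltilde L R (x τ) (deriv x τ) (deriv (deriv x) τ) (g τ) (deriv g τ) v)
            (deriv (deriv g) τ) (Pi.single i 1) = ∑ k, P k τ * R (g τ) k i := by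
    intro i τ
    unfold Ltilde
    rw [chain2 (L (x τ) (deriv x τ) (deriv (deriv x) τ)) (hΦ _ _ _)
      (fun v j => ∑ i, R (g τ) j i * deriv g τ i)
      (fun v k => (∑ i, R (g τ) k i * v i)
        + ∑ s, ∑ i, pderivCoord (fun g' => R g' k i) s (g τ) * deriv g τ s * deriv g τ i)
      (deriv (deriv g) τ) (Pi.single i 1) (fun k => 0)
      (fun k => R (g τ) k i)
      (fun k => differentiableAt_const _)
      (fun k => by fun_prop)
      (fun k => hasDerivAt_const _ _)
      (fun k => by
        have := (HasDerivAt.fun_sum (u := Finset.univ) fun j _ =>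
          (line_coord (deriv (deriv g) τ) i j).const_mul (R (g τ) k j)).add_const
          (∑ s, ∑ i, pderivCoord (fun g' => R g' k i) s (g τ) * deriv g τ s * deriv g τ i)
        simpa using this)]
    simp only [hAe, hBe, mul_zero, zero_add]
    rfl
  have E2 : ∀ i τ, fderiv ℝ (fun v => Ltilde L R (x τ) (deriv x τ) (deriv (deriv x) τ) (g τ) v (deriv (deriv g) τ))
            (deriv g τ) (Pi.single i 1) = ∑ k, (Q k τ * R (g τ) k i
              + P k τ * (deriv (fun τ => R (g τ) k i) τ + S i k τ)) := by
    intro i τ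
    unfold Ltilde
    rw [chain2 (L (x τ) (deriv x τ) (deriv (deriv x) τ)) (hΦ _ _ _)
      (fun v j => ∑ i, R (g τ) j i * v i)
      (fun v k => (∑ i, R (g τ) k i * deriv (deriv g) τ i)
        + ∑ s, ∑ i, pderivCoord (fun g' => R g' k i) s (g τ) * v s * v i)
      (deriv g τ) (Pi.single i 1) (fun k => R (g τ) k i)
      (fun k => deriv (fun τ => R (g τ) k i) τ + S i k τ)
      (fun k => by fun_prop)
      (fun k => by fun_prop)
      (fun k => by
        have := (HasDerivAt.fun_sum (u := Finset.univ) fun j _ =>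
          (line_coord (deriv g τ) i j).const_mul (R (g τ) k j))
        simpa using this)
      (fun k => by
        have := (HasDerivAt.fun_sum (u := Finset.univ) fun s _ =>
          HasDerivAt.fun_sum (u := Finset.univ) fun j _ =>
          ((line_coord (deriv g τ) i s).const_mul
            (pderivCoord (fun g' => R g' k j) s (g τ))).mul
            (line_coord (deriv g τ) i j)).const_add
          (∑ i, R (g τ) k i * deriv (deriv g) τ i)
        refine this.congr_deriv ?_
        rw [hr', hSdef]
        simp [Finset.sum_add_distrib, add_comm])]
    simp only [hAe, hBe]
    rfl
  have E3 : ∀ i τ, fderiv ℝ (fun v => Ltilde L R (x τ) (deriv x τ) (deriv (deriv x) τ) v (deriv g τ) (deriv (deriv g) τ))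
            (g τ) (Pi.single i 1) = ∑ k, (Q k τ * S i k τ
              + P k τ * deriv (S i k) τ) := by
    intro i τ
    unfold Ltilde
    rw [chain2 (L (x τ) (deriv x τ) (deriv (deriv x) τ)) (hΦ _ _ _)
      (fun v j => ∑ i, R v j i * deriv g τ i)
      (fun v k => (∑ i, R v k i * deriv (deriv g) τ i)
        + ∑ s, ∑ i, pderivCoord (fun g' => R g' k i) s v * deriv g τ s * deriv g τ i)
      (g τ) (Pi.single i 1) (fun k => S i k τ)
      (fun k => deriv (S i k) τ)
      (fun k => by fun_prop)
      (fun k => by fun_prop)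
      (fun k => HasDerivAt.fun_sum (u := Finset.univ) fun j _ =>
          (line_pd _ (hR k j) i (g τ)).mul_const _)
      (fun k => by
        rw [hS']
        exact (HasDerivAt.fun_sum (u := Finset.univ) fun j _ =>
          (line_pd _ (hR k j) i (g τ)).mul_const _).add
          (HasDerivAt.fun_sum (u := Finset.univ) fun s _ =>
          HasDerivAt.fun_sum (u := Finset.univ) fun j _ =>
          ((line_pd _ (hRs k j s) i (g τ)).mul_const _).mul_const _))]
    simp only [hAe, hBe]
    rfl
  intro t i
  have main : ∀ s, ∑ k, (deriv (fun τ => deriv (P k) τ - Q k τ) t * R (g t) k s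
      + (deriv (P k) t - Q k t) * (deriv (fun τ => R (g τ) k s) t - S s k t)) = 0 := by
    intro s
    refine EL_1d P Q (fun k τ => R (g τ) k s) (S s) hP hQ (fun k => hRt k s) (hS s) t ?_
    have h := hELg t s
    simp only [E1, E2, E3] at h
    exact h
  change deriv (fun τ => deriv (P i) τ - Q i τ) t
    + ∑ k, ∑ j, c k i j * aC t j * (deriv (P k) t - Q k t) = 0
  set W : Fin n → ℝ := fun k => deriv (P k) t - Q k t with hW
  set W' : Fin n → ℝ := fun k => deriv (fun τ => deriv (P k) τ - Q k τ) t with hW'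
  change W' i + ∑ k, ∑ j, c k i j * aC t j * W k = 0
  have hRR : R (g t) * (R (g t))⁻¹ = 1 := Matrix.mul_nonsing_inv _ (hRinv _)
  have hRR' : (R (g t))⁻¹ * R (g t) = 1 := Matrix.nonsing_inv_mul _ (hRinv _)
  -- contraction with the inverse
  have hinv : ∀ u, ∑ j, (R (g t))⁻¹ u j * aC t j = deriv g t u := by
    intro u
    have h1 : aC t = (R (g t)).mulVec (deriv g t) := by
      funext j; rw [haC]; rfl
    have h2 : (R (g t))⁻¹.mulVec (aC t) = deriv g t := by
      rw [h1, Matrix.mulVec_mulVec, hRR', Matrix.one_mulVec]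
    exact congrFun h2 u
  have hca : ∀ k, ∑ j, c k i j * aC t j
      = ∑ s, (deriv (fun τ => R (g τ) k s) t - S s k t) * (R (g t))⁻¹ s i := by
    intro k
    have h1 : ∀ j, c k i j * aC t j = ∑ s, ∑ u,
        (pderivCoord (fun g' => R g' k s) u (g t) - pderivCoord (fun g' => R g' k u) s (g t))
          * (R (g t))⁻¹ s i * ((R (g t))⁻¹ u j * aC t j) := by
      intro j
      rw [hc (g t) k i j, Finset.sum_mul]
      refine Finset.sum_congr rfl fun s _ => ?_
      rw [Finset.sum_mul]
      exact Finset.sum_congr rfl fun u _ => by ring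
    simp only [h1]
    rw [Finset.sum_comm]
    refine Finset.sum_congr rfl fun s _ => ?_
    rw [Finset.sum_comm]
    simp only [← Finset.mul_sum, hinv]
    rw [hr', hSdef]
    simp only
    rw [← Finset.sum_sub_distrib, Finset.sum_mul]
    exact Finset.sum_congr rfl fun u _ => by ring
  have hW'i : W' i = ∑ s, ∑ k, W' k * R (g t) k s * (R (g t))⁻¹ s i := by
    rw [Finset.sum_comm]
    have : ∀ k, ∑ s, W' k * R (g t) k s * (R (g t))⁻¹ s i = W' k * (1 : Matrix (Fin n) (Fin n) ℝ) k i := by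
      intro k
      rw [← hRR, Matrix.mul_apply, Finset.mul_sum]
      exact Finset.sum_congr rfl fun s _ => by ring
    simp [this, Matrix.one_apply]
  have hfin : ∑ s, (∑ k, (W' k * R (g t) k s
      + W k * (deriv (fun τ => R (g τ) k s) t - S s k t))) * (R (g t))⁻¹ s i = 0 :=
    Finset.sum_eq_zero fun s _ => by rw [main s, zero_mul]
  rw [← hfin, hW'i]
  simp only [← Finset.sum_mul, hca]
  simp only [Finset.sum_add_distrib, add_mul, Finset.sum_mul]
  congr 1
  rw [Finset.sum_comm]
  exact Finset.sum_congr rfl fun s _ => Finset.sum_congr rfl fun k _ => by ring
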